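/- arXiv:2211.16886 — 3 statements merged into one kernel-verified Lean document; each statement's English description precedes it below -/
import Mathlib

section
/- For every probability distribution Γ over [0,1]×{0,1}, the smooth calibration error and the lower distance to calibration satisfy (1/2)·ldCE(Γ) ≤ smCE(Γ) ≤ 2·ldCE(Γ). -/
open MeasureTheory Set

noncomputable section

/-- The unit interval `[0,1]` as a type. -/
abbrev I01 : Type := unitInterval

/-- The real value of a Boolean label. -/
def lbl (y : Bool) : ℝ := if y then 1 else 0

/-- The calibration correlation `E_{(v,y)∼Γ}[(y − v)·w(v)]` against a weight function `w`. -/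
def calErr (Γ : Measure (I01 × Bool)) (w : I01 → ℝ) : ℝ :=
  ∫ p, (lbl p.2 - (p.1 : ℝ)) * w p.1 ∂Γ

/-- A prediction-label distribution `Γ` on `[0,1] × {0,1}` is perfectly calibrated iff
`E[(y − v)·w(v)] = 0` for every bounded measurable weight function `w`. -/
def PerfCal (Γ : Measure (I01 × Bool)) : Prop :=
  ∀ w : I01 → ℝ, Measurable w → (∃ C : ℝ, ∀ t, |w t| ≤ C) → calErr Γ w = 0

/-- `ext(Γ)`: couplings `Π` of triples `(u,v,y)` whose `(v,y)`-marginal is `Γ` and whose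
`(u,y)`-marginal is perfectly calibrated. -/
def extSet (Γ : Measure (I01 × Bool)) : Set (Measure (I01 × I01 × Bool)) :=
  {π | IsProbabilityMeasure π ∧
    π.map (fun p => (p.2.1, p.2.2)) = Γ ∧
    PerfCal (π.map (fun p => (p.1, p.2.2)))}

/-- The lower distance to calibration `ldCE(Γ)`. -/
def ldCE (Γ : Measure (I01 × Bool)) : ℝ :=
  sInf {x | ∃ π ∈ extSet Γ, x = ∫ p, |(p.1 : ℝ) - (p.2.1 : ℝ)| ∂π}

/-- The upper distance to calibration `udCE(Γ)`: distance to calibration via post-processing. -/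
def udCE (Γ : Measure (I01 × Bool)) : ℝ :=
  sInf {x | ∃ κ : I01 → I01, Measurable κ ∧
    PerfCal (Γ.map (fun p => (κ p.1, p.2))) ∧
    x = ∫ p, |(p.1 : ℝ) - (κ p.1 : ℝ)| ∂Γ}

/-- The smooth calibration error `smCE(Γ)`: supremum of `E[(y−v)w(v)]` over `1`-Lipschitz
weight functions `w : [0,1] → [−1,1]`. -/
def smCE (Γ : Measure (I01 × Bool)) : ℝ :=
  sSup {x | ∃ w : I01 → ℝ, LipschitzWith 1 w ∧ (∀ t, |w t| ≤ 1) ∧ x = calErr Γ w}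

/-- The prediction-label distribution `D_f` induced by a predictor `f`. -/
def predDist {𝒳 : Type*} [MeasurableSpace 𝒳] (D : Measure (𝒳 × Bool)) (f : 𝒳 → I01) :
    Measure (I01 × Bool) :=
  D.map (fun p => (f p.1, p.2))

/-- `cal(D)`: the set of measurable predictors that are perfectly calibrated w.r.t. `D`. -/
def calSet {𝒳 : Type*} [MeasurableSpace 𝒳] (D : Measure (𝒳 × Bool)) : Set (𝒳 → I01) :=
  {g | Measurable g ∧ PerfCal (predDist D g)}

/-- The true (ℓ₁) distance to calibration `dCE_D(f)`. -/
def dCE {𝒳 : Type*} [MeasurableSpace 𝒳] (D : Measure (𝒳 × Bool)) (f : 𝒳 → I01) : ℝ :=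
  sInf {x | ∃ g ∈ calSet D, x = ∫ p, |(f p.1 : ℝ) - (g p.1 : ℝ)| ∂D}

/-- A finite partition of `[0,1]` into (order-convex) intervals. -/
structure IntervalPartition where
  m : ℕ
  piece : Fin m → Set ℝ
  ordConn : ∀ j, (piece j).OrdConnected
  disj : ∀ i j, i ≠ j → Disjoint (piece i) (piece j)
  cover : (⋃ j, piece j) = Set.Icc (0 : ℝ) 1

/-- `binnedECE(Γ, 𝓘) = Σ_j |E[(v − y)·1(v ∈ I_j)]|`. -/
def binnedECE (Γ : Measure (I01 × Bool)) (P : IntervalPartition) : ℝ :=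
  ∑ j : Fin P.m,
    |∫ p, Set.indicator (P.piece j) (fun _ => ((p.1 : ℝ) - lbl p.2)) (p.1 : ℝ) ∂Γ|

/-- The average interval width `w_Γ(𝓘) = Σ_j E[1(v ∈ I_j)]·w(I_j)`. -/
def avgWidth (Γ : Measure (I01 × Bool)) (P : IntervalPartition) : ℝ :=
  ∑ j : Fin P.m,
    (∫ p, Set.indicator (P.piece j) (fun _ => (1 : ℝ)) (p.1 : ℝ) ∂Γ) * Metric.diam (P.piece j)

/-- The interval calibration error `intCE(Γ)`. -/
def intCE (Γ : Measure (I01 × Bool)) : ℝ :=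
  sInf {x | ∃ P : IntervalPartition, x = binnedECE Γ P + avgWidth Γ P}

/-- The random interval calibration error `RintCE(Γ, ε)`, with `r` uniform on `[0, ε)` and
intervals `I^ε_{r,j} = [r + jε, r + (j+1)ε)`. -/
def RintCE (Γ : Measure (I01 × Bool)) (ε : ℝ) : ℝ :=
  (1 / ε) * ∫ r in Set.Ico (0 : ℝ) ε,
    ∑' j : ℤ, |∫ p, Set.indicator (Set.Ico (r + (j : ℝ) * ε) (r + ((j : ℝ) + 1) * ε))
      (fun _ => (lbl p.2 - (p.1 : ℝ))) (p.1 : ℝ) ∂Γ|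

/-- The surrogate interval calibration error `SintCE(Γ)`. -/
def SintCE (Γ : Measure (I01 × Bool)) : ℝ :=
  ⨅ k : ℕ, (RintCE Γ ((1 / 2) ^ k) + (1 / 2) ^ k)

/-- The squared Laplace-kernel calibration error:
`K_Lap(Γ) = E[(y−v)(y′−v′)·exp(−|v−v′|)]` over two independent samples from `Γ`. -/
def KLap (Γ : Measure (I01 × Bool)) : ℝ :=
  ∫ q, (lbl q.1.2 - (q.1.1 : ℝ)) * (lbl q.2.2 - (q.2.1 : ℝ)) *
    Real.exp (-|(q.1.1 : ℝ) - (q.2.1 : ℝ)|) ∂(Γ.prod Γ)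

/-- The squared Gaussian-kernel calibration error:
`K_Gauss(Γ) = E[(y−v)(y′−v′)·exp(−(v−v′)²)]` over two independent samples from `Γ`. -/
def KGauss (Γ : Measure (I01 × Bool)) : ℝ :=
  ∫ q, (lbl q.1.2 - (q.1.1 : ℝ)) * (lbl q.2.2 - (q.2.1 : ℝ)) *
    Real.exp (-(((q.1.1 : ℝ) - (q.2.1 : ℝ)) ^ 2)) ∂(Γ.prod Γ)

lemma aux_intb {Ω : Type*} [MeasurableSpace Ω] (Γ : Measure Ω) [IsFiniteMeasure Γ] (f : Ω → ℝ)
    (hf : Measurable f) (C : ℝ) (h : ∀ p, |f p| ≤ C) : Integrable f Γ :=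
  Integrable.of_bound hf.aestronglyMeasurable C (Filter.Eventually.of_forall h)

lemma aux_intq {Ω Q : Type*} [MeasurableSpace Ω] [MeasurableSpace Q] [Fintype Q]
    [MeasurableSingletonClass Q] (Γ : Measure Ω) [IsFiniteMeasure Γ] (q : Ω → Q) (hq : Measurable q)
    (ψ : Q → ℝ) (h : Ω → ℝ) (hh : Measurable h) (C : ℝ) (hC : ∀ p, |h p| ≤ C) :
    Integrable (fun p => ψ (q p) * h p) Γ := by
  refine aux_intb Γ _ (((measurable_of_countable ψ).comp hq).mul hh) ((∑ i, |ψ i|) * C) ?_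
  intro p
  rw [abs_mul]
  have h1 : |ψ (q p)| ≤ ∑ i, |ψ i| :=
    Finset.single_le_sum (f := fun i => |ψ i|) (fun i _ => abs_nonneg _) (Finset.mem_univ _)
  exact mul_le_mul h1 (hC p) (abs_nonneg _) (Finset.sum_nonneg fun i _ => abs_nonneg _)

lemma aux_duality {Ω Q U : Type*} [MeasurableSpace Ω] [MeasurableSpace Q] [Fintype Q] [Fintype U]
    [MeasurableSingletonClass Q] (Γ : Measure Ω) [IsFiniteMeasure Γ] (q : Ω → Q) (hq : Measurable q)
    (A B : U → Ω → ℝ) (hA : ∀ u, Measurable (A u)) (hB : ∀ u, Measurable (B u))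
    (hA1 : ∀ u p, |A u p| ≤ 1) (hB1 : ∀ u p, |B u p| ≤ 1)
    (φ₀ : Q → U → ℝ) (h₀ : ∀ i, φ₀ i ∈ stdSimplex ℝ U)
    (h₀A : ∀ u, ∫ p, φ₀ (q p) u * A u p ∂Γ = 0) (c : ℝ) :
    (∃ φ : Q → U → ℝ, (∀ i, φ i ∈ stdSimplex ℝ U) ∧ (∀ u, ∫ p, φ (q p) u * A u p ∂Γ = 0) ∧
      ∑ u, ∫ p, φ (q p) u * B u p ∂Γ ≤ c) ∨
    ∃ s : U → ℝ, ∀ φ : Q → U → ℝ, (∀ i, φ i ∈ stdSimplex ℝ U) →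
      c < ∑ u, ∫ p, φ (q p) u * (B u p + s u * A u p) ∂Γ := by
  classical
  have iA : ∀ (φ : Q → U → ℝ) u, Integrable (fun p => φ (q p) u * A u p) Γ := fun φ u =>
    aux_intq Γ q hq (fun i => φ i u) _ (hA u) 1 (hA1 u)
  have iB : ∀ (φ : Q → U → ℝ) u, Integrable (fun p => φ (q p) u * B u p) Γ := fun φ u =>
    aux_intq Γ q hq (fun i => φ i u) _ (hB u) 1 (hB1 u)
  let T : (Q → U → ℝ) →ₗ[ℝ] ((U → ℝ) × ℝ) :=
    { toFun := fun φ => (fun u => ∫ p, φ (q p) u * A u p ∂Γ, ∑ u, ∫ p, φ (q p) u * B u p ∂Γ)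
      map_add' := by
        intro φ ψ
        ext u
        · simp only [Pi.add_apply, add_mul, Prod.fst_add]
          exact integral_add (iA φ u) (iA ψ u)
        · simp only [Pi.add_apply, add_mul, Prod.snd_add, ← Finset.sum_add_distrib]
          exact Finset.sum_congr rfl fun u _ => integral_add (iB φ u) (iB ψ u)
      map_smul' := by
        intro r φ
        ext u
        · simp [mul_assoc, integral_const_mul]
        · simp [mul_assoc, integral_const_mul, Finset.mul_sum] }
  let X : Set (Q → U → ℝ) := Set.univ.pi fun _ => stdSimplex ℝ U
  have hXc : IsCompact X := isCompact_univ_pi fun _ => isCompact_stdSimplex ℝ U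
  have hXv : Convex ℝ X := convex_pi fun _ _ => convex_stdSimplex ℝ U
  have hTc : Continuous T := T.continuous_of_finiteDimensional
  let L : Set ((U → ℝ) × ℝ) := {0} ×ˢ Iic c
  by_cases hd : Disjoint (T '' X) L
  · right
    obtain ⟨f, a, b, h1, h2, h3⟩ := geometric_hahn_banach_compact_closed (hXv.linear_image T)
      (hXc.image hTc) ((convex_singleton 0).prod (convex_Iic c))
      (isClosed_singleton.prod isClosed_Iic) hd
    have hf : ∀ (x : U → ℝ) (t : ℝ), f (x, t) = ∑ u, x u * f (Pi.single u 1, 0) + t * f (0, 1) := by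
      intro x t
      have : (x, t) = ∑ u, x u • ((Pi.single u (1:ℝ) : U → ℝ), (0:ℝ)) + t • ((0 : U → ℝ), (1:ℝ)) := by
        ext u
        · simp [Prod.fst_sum, Finset.sum_apply, Pi.single_apply]
        · simp [Prod.snd_sum]
      conv_lhs => rw [this]
      simp only [map_add, map_sum, map_smul, smul_eq_mul]
    set l := f (0, 1) with hl
    have h3' : ∀ t ≤ c, b < t * l := by
      intro t ht
      have := h3 (0, t) ⟨rfl, ht⟩
      rw [hf] at this
      simpa using this
    have h1' : ∀ φ : Q → U → ℝ, (∀ i, φ i ∈ stdSimplex ℝ U) →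
        ∑ u, (∫ p, φ (q p) u * A u p ∂Γ) * f (Pi.single u 1, 0)
          + (∑ u, ∫ p, φ (q p) u * B u p ∂Γ) * l < a := by
      intro φ hφ
      have := h1 (T φ) ⟨φ, fun i _ => hφ i, rfl⟩
      rw [← hf]
      exact this
    have hl0 : l < 0 := by
      rcases lt_trichotomy l 0 with h | h | h
      · exact h
      · have e1 := h1' φ₀ h₀
        have e2 := h3' c le_rfl
        simp only [h₀A, h] at e1 e2
        simp at e1 e2
        linarith
      · exfalso
        have e2 := h3' (min c (b / l)) (min_le_left _ _)
        have : min c (b / l) * l ≤ b / l * l := by gcongr; exact min_le_right _ _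
        rw [div_mul_cancel₀ _ h.ne'] at this
        linarith
    refine ⟨fun u => f (Pi.single u 1, 0) / l, fun φ hφ => ?_⟩
    have e1 := h1' φ hφ
    have e2 := h3' c le_rfl
    have e3 : ∑ u, ∫ p, φ (q p) u * (B u p + f (Pi.single u 1, 0) / l * A u p) ∂Γ
        = ∑ u, ∫ p, φ (q p) u * B u p ∂Γ
          + (∑ u, (∫ p, φ (q p) u * A u p ∂Γ) * f (Pi.single u 1, 0)) / l := by
      rw [Finset.sum_div, ← Finset.sum_add_distrib]
      refine Finset.sum_congr rfl fun u _ => ?_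
      rw [mul_div_assoc, ← integral_mul_const, ← integral_add (iB φ u) ((iA φ u).mul_const _)]
      congr 1
      ext p
      ring
    rw [e3]
    by_contra hcon
    push Not at hcon
    have := mul_le_mul_of_nonpos_right hcon hl0.le
    rw [add_mul, div_mul_cancel₀ _ hl0.ne] at this
    linarith
  · left
    rw [Set.not_disjoint_iff] at hd
    obtain ⟨_, ⟨φ, hφ, rfl⟩, h1, h2⟩ := hd
    exact ⟨φ, fun i => hφ i trivial, fun u => congrFun h1 u, h2⟩

lemma lbl_meas : Measurable lbl := measurable_of_countable _

lemma lbl_cases (y : Bool) : lbl y = 0 ∨ lbl y = 1 := by cases y <;> simp [lbl]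

lemma aux_lbl_abs (y : Bool) (v : I01) : |lbl y - (v : ℝ)| ≤ 1 := by
  have h0 := v.2.1
  have h1 := v.2.2
  rw [abs_le]
  rcases lbl_cases y with h | h <;> rw [h] <;> constructor <;> linarith

lemma aux_abs_sub (u v : I01) : |(u : ℝ) - v| ≤ 1 := by
  have h0 := v.2.1
  have h1 := v.2.2
  have h2 := u.2.1
  have h3 := u.2.2
  rw [abs_le]
  constructor <;> linarith

lemma aux_primal {Q U : Type*} [MeasurableSpace Q] [Fintype Q] [Fintype U]
    [MeasurableSingletonClass Q] (Γ : Measure (I01 × Bool)) [IsProbabilityMeasure Γ]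
    (q : I01 × Bool → Q) (hq : Measurable q) (g : U → I01)
    (φ : Q → U → ℝ) (hφ : ∀ i, φ i ∈ stdSimplex ℝ U)
    (h : ∀ u, ∫ p, φ (q p) u * (lbl p.2 - (g u : ℝ)) ∂Γ = 0) :
    ldCE Γ ≤ ∑ u, ∫ p, φ (q p) u * |(g u : ℝ) - (p.1 : ℝ)| ∂Γ := by
  let d : U → I01 × Bool → ENNReal := fun u p => ENNReal.ofReal (φ (q p) u)
  have hd : ∀ u, Measurable (d u) := fun u =>
    (measurable_of_countable (fun i => ENNReal.ofReal (φ i u))).comp hq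
  have hmk : ∀ u, Measurable (fun p : I01 × Bool => (g u, p)) := fun u =>
    measurable_const.prodMk measurable_id
  let π : Measure (I01 × I01 × Bool) :=
    ∑ u, (Γ.withDensity (d u)).map (fun p => (g u, p))
  have hfin : ∀ u, IsFiniteMeasure (Γ.withDensity (d u)) := by
    intro u
    refine isFiniteMeasure_withDensity_ofReal ?_
    have := aux_intq Γ q hq (fun i => φ i u) (fun _ => 1) measurable_const 1 (by simp)
    simp only [mul_one] at this
    exact this.2
  have hint : ∀ (F : I01 × I01 × Bool → ℝ), Measurable F → (∃ C, ∀ p, |F p| ≤ C) →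
      ∫ p, F p ∂π = ∑ u, ∫ p, φ (q p) u * F (g u, p) ∂Γ := by
    rintro F hF ⟨C, hC⟩
    rw [integral_finsetSum_measure]
    · refine Finset.sum_congr rfl fun u _ => ?_
      rw [integral_map (hmk u).aemeasurable hF.aestronglyMeasurable,
        integral_withDensity_eq_integral_toReal_smul (hd u)
          (Filter.Eventually.of_forall fun _ => ENNReal.ofReal_lt_top)]
      congr 1
      ext p
      simp only [d, smul_eq_mul]
      rw [ENNReal.toReal_ofReal ((hφ _).1 u)]
    · intro u _
      exact aux_intb _ _ hF C hC
  have hmap : π.map (fun p => p.2) = Γ := by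
    rw [Measure.map_finset_sum measurable_snd.aemeasurable]
    have : ∀ u, ((Γ.withDensity (d u)).map (fun p => (g u, p))).map (fun p => p.2)
        = Γ.withDensity (d u) := by
      intro u
      rw [Measure.map_map measurable_snd (hmk u)]
      exact Measure.map_id
    simp only [this]
    ext s hs
    rw [Measure.finsetSum_apply]
    simp only [withDensity_apply _ hs]
    rw [← lintegral_finsetSum _ fun u _ => hd u]
    have : ∀ p, ∑ u, d u p = 1 := by
      intro p
      simp only [d]
      rw [← ENNReal.ofReal_sum_of_nonneg fun u _ => (hφ _).1 u, (hφ _).2, ENNReal.ofReal_one]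
    simp [this]
  have hπ : π ∈ extSet Γ := by
    refine ⟨?_, hmap, ?_⟩
    · have h1 : IsProbabilityMeasure (π.map (fun p => p.2)) := by rw [hmap]; infer_instance
      exact (Measure.isProbabilityMeasure_map_iff measurable_snd.aemeasurable).1 h1
    · rintro w hw ⟨C, hC⟩
      have hm1 : Measurable (fun p : I01 × I01 × Bool => (p.1, p.2.2)) := by fun_prop
      have hm2 : Measurable (fun p : I01 × Bool => (lbl p.2 - (p.1 : ℝ)) * w p.1) :=
        ((lbl_meas.comp measurable_snd).sub (measurable_subtype_coe.comp measurable_fst)).mul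
          (hw.comp measurable_fst)
      rw [calErr, integral_map hm1.aemeasurable hm2.aestronglyMeasurable,
        hint (fun p => (lbl p.2.2 - (p.1 : ℝ)) * w p.1) (hm2.comp hm1)]
      · refine Finset.sum_eq_zero fun u _ => ?_
        simp only [← mul_assoc]
        rw [integral_mul_const, h, zero_mul]
      · refine ⟨1 * C, fun p => ?_⟩
        rw [abs_mul]
        exact mul_le_mul (aux_lbl_abs _ _) (hC _) (abs_nonneg _) zero_le_one
  rw [← hint (fun p => |(p.1 : ℝ) - (p.2.1 : ℝ)|) (by fun_prop)
    ⟨1, fun p => by rw [abs_abs]; exact aux_abs_sub _ _⟩]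
  refine csInf_le ⟨0, ?_⟩ ⟨π, hπ, rfl⟩
  rintro x ⟨π, -, rfl⟩
  exact integral_nonneg fun p => abs_nonneg _

lemma aux_ext_nonempty (Γ : Measure (I01 × Bool)) [IsProbabilityMeasure Γ] :
    (extSet Γ).Nonempty := by
  have hm : Measurable (fun p : I01 × Bool => ((if p.2 then 1 else 0 : I01), p)) :=
    ((measurable_of_countable (fun y : Bool => (if y then 1 else 0 : I01))).comp
      measurable_snd).prodMk measurable_id
  refine ⟨Γ.map (fun p => ((if p.2 then 1 else 0 : I01), p)), ?_, ?_, ?_⟩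
  · exact Measure.isProbabilityMeasure_map hm.aemeasurable
  · rw [Measure.map_map (by fun_prop) hm]
    exact Measure.map_id
  · rintro w hw -
    have hm1 : Measurable (fun p : I01 × I01 × Bool => (p.1, p.2.2)) := by fun_prop
    have hm2 : Measurable (fun p : I01 × Bool => (lbl p.2 - (p.1 : ℝ)) * w p.1) :=
      ((lbl_meas.comp measurable_snd).sub (measurable_subtype_coe.comp measurable_fst)).mul
        (hw.comp measurable_fst)
    rw [calErr, integral_map hm1.aemeasurable hm2.aestronglyMeasurable,
      integral_map hm.aemeasurable (f := fun x : I01 × I01 × Bool =>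
        (lbl (x.1, x.2.2).2 - ((x.1, x.2.2).1 : ℝ)) * w (x.1, x.2.2).1)
        (hm2.comp hm1).aestronglyMeasurable]
    rw [← integral_zero (I01 × Bool) ℝ (μ := Γ)]
    congr 1
    ext p
    cases h : p.2 <;> simp [lbl]

lemma aux_cal_le (Γ : Measure (I01 × Bool)) [IsProbabilityMeasure Γ] (w : I01 → ℝ)
    (hw : LipschitzWith 1 w) (hb : ∀ t, |w t| ≤ 1) : calErr Γ w ≤ smCE Γ := by
  refine le_csSup ⟨1, ?_⟩ ⟨w, hw, hb, rfl⟩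
  rintro x ⟨w, hw, hb, rfl⟩
  have := norm_integral_le_of_norm_le_const (μ := Γ) (C := 1)
    (f := fun p : I01 × Bool => (lbl p.2 - (p.1 : ℝ)) * w p.1)
    (Filter.Eventually.of_forall fun p => by
      rw [Real.norm_eq_abs, abs_mul]
      exact mul_le_one₀ (aux_lbl_abs _ _) (abs_nonneg _) (hb _))
  rw [probReal_univ, mul_one, Real.norm_eq_abs] at this
  exact (le_abs_self _).trans this

lemma aux_upper (Γ : Measure (I01 × Bool)) [IsProbabilityMeasure Γ] : smCE Γ ≤ 2 * ldCE Γ := by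
  refine csSup_le ⟨_, fun _ => 0, LipschitzWith.const' 0, by simp, rfl⟩ ?_
  rintro x ⟨w, hw, hb, rfl⟩
  suffices calErr Γ w / 2 ≤ ldCE Γ by linarith
  obtain ⟨π₀, h₀⟩ := aux_ext_nonempty Γ
  refine le_csInf ⟨_, π₀, h₀, rfl⟩ ?_
  rintro x ⟨π, ⟨hp, h1, h2⟩, rfl⟩
  have hwm : Measurable w := hw.continuous.measurable
  have hm2 : Measurable (fun p : I01 × Bool => (lbl p.2 - (p.1 : ℝ)) * w p.1) :=
    ((lbl_meas.comp measurable_snd).sub (measurable_subtype_coe.comp measurable_fst)).mul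
      (hwm.comp measurable_fst)
  have hbd : ∀ p : I01 × Bool, |(lbl p.2 - (p.1 : ℝ)) * w p.1| ≤ 1 := fun p => by
    rw [abs_mul]
    exact mul_le_one₀ (aux_lbl_abs _ _) (abs_nonneg _) (hb _)
  have hm1 : Measurable (fun p : I01 × I01 × Bool => (p.1, p.2.2)) := by fun_prop
  have e0 := h2 w hwm ⟨1, hb⟩
  have hm3 : Measurable (fun p : I01 × I01 × Bool => (p.2.1, p.2.2)) := by fun_prop
  rw [calErr, integral_map hm1.aemeasurable hm2.aestronglyMeasurable] at e0
  have e1 : calErr Γ w = ∫ p, (lbl p.2.2 - (p.2.1 : ℝ)) * w p.2.1 ∂π := by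
    conv_lhs => rw [← h1]
    rw [calErr, integral_map hm3.aemeasurable hm2.aestronglyMeasurable]
  have i1 : Integrable (fun p : I01 × I01 × Bool => (lbl p.2.2 - (p.1 : ℝ)) * w p.1) π :=
    aux_intb _ _ (hm2.comp hm1) 1 fun p => hbd (p.1, p.2.2)
  have i2 : Integrable (fun p : I01 × I01 × Bool => (lbl p.2.2 - (p.2.1 : ℝ)) * w p.2.1) π :=
    aux_intb _ _ (hm2.comp hm3) 1 fun p => hbd (p.2.1, p.2.2)
  have i3 : Integrable (fun p : I01 × I01 × Bool => |(p.1 : ℝ) - (p.2.1 : ℝ)|) π :=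
    aux_intb _ _ (by fun_prop) 1 fun p => by rw [abs_abs]; exact aux_abs_sub _ _
  have e2 : calErr Γ w ≤ ∫ p, 2 * |(p.1 : ℝ) - (p.2.1 : ℝ)| ∂π := by
    rw [e1, ← sub_zero (∫ p, _ ∂π), ← e0, ← integral_sub i2 i1]
    refine integral_mono (i2.sub i1) (i3.const_mul 2) ?_
    rintro ⟨u, v, y⟩
    simp only
    have a1 : |w v - w u| ≤ |(u : ℝ) - v| := by
      have := hw.dist_le_mul v u
      rw [dist_comm v u] at this
      simpa [Real.dist_eq, Subtype.dist_eq] using this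
    have a2 : (lbl y - v) * (w v - w u) ≤ |(u : ℝ) - v| := by
      refine (le_abs_self _).trans ?_
      rw [abs_mul]
      nlinarith [aux_lbl_abs y v, abs_nonneg (w v - w u)]
    have a3 : ((u : ℝ) - v) * w u ≤ |(u : ℝ) - v| := by
      refine (le_abs_self _).trans ?_
      rw [abs_mul]
      nlinarith [hb u, abs_nonneg ((u : ℝ) - v)]
    linarith
  rw [integral_const_mul] at e2
  linarith

lemma aux_dual_pt {U : Type*} [Fintype U] [Nonempty U] (g : U → I01) (u₀ u₁ : U) (hu₀ : g u₀ = 0)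
    (hu₁ : g u₁ = 1) (s : U → ℝ) (ε : ℝ) (hε : 0 < ε)
    (hg : ∀ v : I01, ∃ u, |(v : ℝ) - g u| ≤ ε) :
    ∃ w : I01 → ℝ, LipschitzWith 1 w ∧ (∀ t, |w t| ≤ 1) ∧ ∀ (v : I01) (y : Bool),
      ∃ u, |(g u : ℝ) - v| + s u * (lbl y - g u) ≤ 2 * ((lbl y - v) * w v) + 3 * ε := by
  let R : Bool → I01 → ℝ := fun y v =>
    Finset.univ.inf' Finset.univ_nonempty fun u => |(g u : ℝ) - v| + s u * (lbl y - g u)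
  have hR : ∀ y v u, R y v ≤ |(g u : ℝ) - v| + s u * (lbl y - g u) := fun y v u =>
    Finset.inf'_le _ (Finset.mem_univ u)
  have hRe : ∀ y v, ∃ u, R y v = |(g u : ℝ) - v| + s u * (lbl y - g u) := fun y v => by
    obtain ⟨u, -, h⟩ := Finset.exists_mem_eq_inf' (Finset.univ_nonempty)
      fun u => |(g u : ℝ) - v| + s u * (lbl y - g u)
    exact ⟨u, h⟩
  have hL : ∀ y v v', R y v ≤ R y v' + |(v : ℝ) - v'| := by
    intro y v v'
    obtain ⟨u, hu⟩ := hRe y v'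
    have h1 := hR y v u
    have h2 := abs_sub_le (g u : ℝ) v' v
    rw [abs_sub_comm (v' : ℝ) v] at h2
    linarith
  have hL0 : LipschitzWith 1 fun v => (R true v - R false v) / 2 := by
    refine LipschitzWith.of_dist_le_mul fun v v' => ?_
    rw [Real.dist_eq, Subtype.dist_eq, Real.dist_eq, abs_le]
    have h1 := hL true v v'
    have h2 := hL true v' v
    have h3 := hL false v v'
    have h4 := hL false v' v
    rw [abs_sub_comm (v' : ℝ) v] at h2 h4
    simp only [NNReal.coe_one, one_mul]
    constructor <;> linarith
  refine ⟨fun v => max (-1) (min 1 ((R true v - R false v) / 2)),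
    (hL0.const_min 1).const_max (-1), fun t => ?_, fun v y => ?_⟩
  · rw [abs_le]
    exact ⟨le_max_left _ _, max_le (by norm_num) (min_le_left _ _)⟩
  · obtain ⟨u, hu⟩ := hRe y v
    refine ⟨u, ?_⟩
    rw [← hu]
    have b0 := hR false v u₀
    have b1 := hR true v u₁
    obtain ⟨z, hz⟩ := hg v
    have z0 := hR false v z
    have z1 := hR true v z
    rw [hu₀] at b0
    rw [hu₁] at b1
    have v0 := v.2.1
    have v1 := v.2.2
    have g0 := (g z).2.1
    have g1 := (g z).2.2
    rw [abs_sub_comm] at hz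
    simp only [lbl] at b0 b1 z0 z1
    simp at b0 b1 z0 z1
    rw [abs_of_nonneg v0] at b0
    rw [abs_of_nonneg (by linarith)] at b1
    generalize hr0 : R false v = r0 at *
    generalize hr1 : R true v = r1 at *
    have key : (1 - (g z : ℝ)) * r0 + g z * r1 ≤ ε := by
      nlinarith
    have habs := abs_le.1 hz
    beta_reduce
    rw [hr0, hr1]
    rcases le_total ((r1 - r0) / 2) 1 with c1 | c1
    · rw [min_eq_right c1]
      rcases le_total (-1) ((r1 - r0) / 2) with c2 | c2
      · rw [max_eq_right c2]
        have : ((g z : ℝ) - v) * (r1 - r0) ≥ - (2 * ε) := by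
          have : |((g z : ℝ) - v) * (r1 - r0)| ≤ ε * 2 := by
            rw [abs_mul]
            exact mul_le_mul hz (abs_le.2 ⟨by linarith, by linarith⟩) (abs_nonneg _) hε.le
          linarith [(abs_le.1 this).1]
        cases y
        · rw [hr0]; simp only [lbl]; simp; nlinarith
        · rw [hr1]; simp only [lbl]; simp; nlinarith
      · rw [max_eq_left c2]
        cases y
        · rw [hr0]; simp only [lbl]; simp; nlinarith
        · rw [hr1]; simp only [lbl]; simp; nlinarith
    · rw [min_eq_left c1, max_eq_right (by norm_num)]
      cases y
      · rw [hr0]; simp only [lbl]; simp; nlinarith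
      · rw [hr1]; simp only [lbl]; simp; nlinarith

lemma aux_lower (Γ : Measure (I01 × Bool)) [IsProbabilityMeasure Γ] (n : ℕ) (hn : 0 < n) :
    ldCE Γ ≤ 2 * smCE Γ + 5 * (1 / n : ℝ) := by
  classical
  have hn' : (0 : ℝ) < n := by exact_mod_cast hn
  let g : Fin (n + 1) → I01 := fun u => ⟨(u : ℝ) / n, by positivity, by
    rw [div_le_one hn']; exact_mod_cast Nat.lt_succ_iff.1 u.2⟩
  let rd : I01 → Fin (n + 1) := fun v => Fin.ofNat (n + 1) ⌊(n : ℝ) * v⌋₊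
  have hrdm : Measurable rd := (measurable_of_countable (fun k : ℕ => Fin.ofNat (n + 1) k)).comp
    (Nat.measurable_floor.comp (measurable_const.mul measurable_subtype_coe))
  have hrd : ∀ v : I01, |(v : ℝ) - g (rd v)| ≤ 1 / n := by
    intro v
    have v0 := v.2.1
    have v1 := v.2.2
    have h0 : (0 : ℝ) ≤ n * v := by positivity
    have h1 : ⌊(n : ℝ) * v⌋₊ < n + 1 := by
      have : ⌊(n : ℝ) * v⌋₊ ≤ ⌊(n : ℝ)⌋₊ := Nat.floor_mono (by nlinarith)
      rw [Nat.floor_natCast] at this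
      omega
    have h2 : ((rd v : ℕ)) = ⌊(n : ℝ) * v⌋₊ := by
      simp only [rd, Fin.val_ofNat]
      exact Nat.mod_eq_of_lt h1
    have h3 : (g (rd v) : ℝ) = (⌊(n : ℝ) * v⌋₊ : ℝ) / n := by
      simp only [g, h2]
    have h4 := Nat.floor_le h0
    have h5 := Nat.lt_floor_add_one ((n : ℝ) * v)
    have h6 : (v : ℝ) = (n * v) / n := by field_simp
    rw [h3, h6, ← sub_div, abs_div, abs_of_pos hn', mul_div_cancel_left₀ _ hn'.ne']
    gcongr
    rw [abs_le]
    constructor <;> linarith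
  have hg0 : g 0 = 0 := by ext; simp [g]
  have hg1 : g (Fin.last n) = 1 := by ext; simp [g, hn'.ne']
  let q : I01 × Bool → Fin (n + 1) × Bool := fun p => (rd p.1, p.2)
  have hq : Measurable q := (hrdm.comp measurable_fst).prodMk measurable_snd
  by_contra hcon
  push Not at hcon
  have hAm : ∀ u, Measurable fun p : I01 × Bool => lbl p.2 - (g u : ℝ) := fun u =>
    (lbl_meas.comp measurable_snd).sub_const _
  have hBm : ∀ u, Measurable fun p : I01 × Bool => |(g u : ℝ) - (p.1 : ℝ)| := fun u => by fun_prop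
  rcases aux_duality Γ q hq (fun u p => lbl p.2 - (g u : ℝ)) (fun u p => |(g u : ℝ) - (p.1 : ℝ)|)
    hAm hBm (fun u p => aux_lbl_abs _ _)
    (fun u p => by rw [abs_abs]; exact aux_abs_sub _ _)
    (fun i => Pi.single (if i.2 then Fin.last n else 0) 1) (fun i => single_mem_stdSimplex ℝ _)
    (by
      intro u
      rw [← integral_zero (I01 × Bool) ℝ (μ := Γ)]
      congr 1
      ext ⟨v, y⟩
      simp only [q, Pi.single_apply]
      split_ifs with h1 h2 h2
      · subst h2; rw [hg1]; simp [lbl, h1]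
      · simp
      · subst h2; rw [hg0]; simp [lbl, h1]
      · simp) (2 * smCE Γ + 5 * (1 / n : ℝ)) with ⟨φ, hφ, ha, hb⟩ | ⟨s, hs⟩
  · have := aux_primal Γ q hq g φ hφ ha
    linarith
  · obtain ⟨w, hw, hb, hp⟩ := aux_dual_pt g 0 (Fin.last n) hg0 hg1 s (1 / n) (by positivity)
      fun v => ⟨_, hrd v⟩
    have hmin : ∀ i : Fin (n + 1) × Bool, ∃ u, ∀ u',
        |(g u : ℝ) - g i.1| + s u * (lbl i.2 - g u) ≤ |(g u' : ℝ) - g i.1| + s u' * (lbl i.2 - g u') := by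
      intro i
      obtain ⟨u, -, h⟩ := Finset.exists_min_image Finset.univ
        (fun u => |(g u : ℝ) - g i.1| + s u * (lbl i.2 - g u)) Finset.univ_nonempty
      exact ⟨u, fun u' => h u' (Finset.mem_univ _)⟩
    choose m hm using hmin
    have h1 := hs (fun i => Pi.single (m i) 1) (fun i => single_mem_stdSimplex ℝ _)
    have hi : ∀ u, Integrable (fun p => (Pi.single (m (q p)) 1 : Fin (n + 1) → ℝ) u *
        (|(g u : ℝ) - (p.1 : ℝ)| + s u * (lbl p.2 - (g u : ℝ)))) Γ := by
      intro u
      refine aux_intq Γ q hq (fun i => (Pi.single (m i) 1 : Fin (n + 1) → ℝ) u) _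
        ((hBm u).add ((hAm u).const_mul (s u))) (1 + |s u| * 1) fun p => ?_
      refine (abs_add_le _ _).trans ?_
      rw [abs_mul, abs_abs]
      gcongr
      · exact aux_abs_sub _ _
      · exact aux_lbl_abs _ _
    rw [← integral_finsetSum _ fun u _ => hi u] at h1
    have hwm : Measurable w := hw.continuous.measurable
    have hm2 : Measurable (fun p : I01 × Bool => (lbl p.2 - (p.1 : ℝ)) * w p.1) :=
      ((lbl_meas.comp measurable_snd).sub (measurable_subtype_coe.comp measurable_fst)).mul
        (hwm.comp measurable_fst)
    have i2 : Integrable (fun p : I01 × Bool => (lbl p.2 - (p.1 : ℝ)) * w p.1) Γ :=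
      aux_intb _ _ hm2 1 fun p => by
        rw [abs_mul]
        exact mul_le_one₀ (aux_lbl_abs _ _) (abs_nonneg _) (hb _)
    have h2 := integral_mono (μ := Γ) (integrable_finsetSum Finset.univ fun u _ => hi u)
      ((i2.const_mul 2).add (integrable_const (5 * (1 / n : ℝ)))) (by
        rintro ⟨v, y⟩
        simp only [Pi.add_apply, Pi.single_apply, ite_mul, one_mul, zero_mul,
          Finset.sum_ite_eq', Finset.sum_ite_eq, Finset.mem_univ, if_true]
        obtain ⟨u, hu⟩ := hp v y
        have k1 := hm (q (v, y)) u
        simp only [q] at k1 ⊢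
        have k2 := hrd v
        have k3 := abs_sub_le (g u : ℝ) v (g (rd v))
        have k4 := abs_sub_le (g (m (rd v, y)) : ℝ) (g (rd v)) v
        rw [abs_sub_comm (g (rd v) : ℝ) v] at k4
        linarith)
    have h3 := aux_cal_le Γ w hw hb
    simp only [Pi.add_apply] at h2
    rw [integral_add (i2.const_mul 2) (integrable_const _), integral_const_mul] at h2
    simp only [integral_const, probReal_univ, one_smul] at h2
    unfold calErr at h3
    linarith

/-- For every probability distribution `Γ` over `[0,1]×{0,1}`,
`(1/2)·ldCE(Γ) ≤ smCE(Γ) ≤ 2·ldCE(Γ)`. -/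
theorem smCE_approximates_ldCE (Γ : Measure (I01 × Bool)) [IsProbabilityMeasure Γ] :
    (1 / 2 : ℝ) * ldCE Γ ≤ smCE Γ ∧ smCE Γ ≤ 2 * ldCE Γ := by

  refine ⟨?_, aux_upper Γ⟩
  suffices ldCE Γ ≤ 2 * smCE Γ by linarith
  refine le_of_forall_pos_le_add fun ε hε => ?_
  obtain ⟨n, hn⟩ := exists_nat_one_div_lt (show (0 : ℝ) < ε / 5 by positivity)
  have := aux_lower Γ (n + 1) n.succ_pos
  push_cast at this
  linarith
end
end

section
/- For every measurable space 𝒳, every probability distribution D over 𝒳×{0,1}, and every measurable predictor f:𝒳→[0,1], it holds that dCE_D(f) ≤ intCE(D_f) ≤ 4·√(dCE_D(f)). -/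
open MeasureTheory Set

noncomputable section

lemma lbl_nonneg (y : Bool) : 0 ≤ lbl y := by unfold lbl; split_ifs <;> norm_num
lemma lbl_le (y : Bool) : lbl y ≤ 1 := by unfold lbl; split_ifs <;> norm_num

lemma exists_idx (P : IntervalPartition) :
    ∃ idx : I01 → Fin P.m, Measurable idx ∧ ∀ (t : I01) j, (t : ℝ) ∈ P.piece j ↔ idx t = j := by
  have h : ∀ t : I01, ∃ j, (t : ℝ) ∈ P.piece j := by
    intro t
    have : (t : ℝ) ∈ ⋃ j, P.piece j := by rw [P.cover]; exact t.2
    simpa using this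
  choose idx hidx using h
  have key : ∀ (t : I01) j, (t : ℝ) ∈ P.piece j ↔ idx t = j := by
    intro t j
    constructor
    · intro hj
      by_contra hne
      exact Set.disjoint_left.1 (P.disj _ _ hne) (hidx t) hj
    · rintro rfl
      exact hidx t
  refine ⟨idx, ?_, key⟩
  apply measurable_to_countable'
  intro j
  have : idx ⁻¹' {j} = (fun t : I01 => (t : ℝ)) ⁻¹' (P.piece j) := by
    ext t; simp [key]
  rw [this]
  exact measurable_subtype_coe (P.ordConn j).measurableSet

section
variable {𝒳 : Type*} [MeasurableSpace 𝒳]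

lemma pred_meas {f : 𝒳 → I01} (hf : Measurable f) :
    Measurable (fun p : 𝒳 × Bool => (f p.1, p.2)) :=
  (hf.comp measurable_fst).prodMk measurable_snd

lemma val_meas {f : 𝒳 → I01} (hf : Measurable f) :
    Measurable (fun p : 𝒳 × Bool => (f p.1 : ℝ)) :=
  measurable_subtype_coe.comp (hf.comp measurable_fst)

lemma lbl_meas2 : Measurable (fun p : 𝒳 × Bool => lbl p.2) := lbl_meas.comp measurable_snd

lemma int_bdd {Ω : Type*} [MeasurableSpace Ω] {D : Measure Ω} [IsFiniteMeasure D]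
    {F : Ω → ℝ} (hF : Measurable F) (C : ℝ) (hC : ∀ p, |F p| ≤ C) : Integrable F D :=
  Integrable.of_bound hF.aestronglyMeasurable C (Filter.Eventually.of_forall (by simpa using hC))

lemma int_val (D : Measure (𝒳 × Bool)) [IsFiniteMeasure D] {f : 𝒳 → I01} (hf : Measurable f) :
    Integrable (fun p : 𝒳 × Bool => (f p.1 : ℝ)) D :=
  int_bdd (val_meas hf) 1 (fun p => by rw [abs_of_nonneg (f p.1).2.1]; exact (f p.1).2.2)

lemma int_lbl (D : Measure (𝒳 × Bool)) [IsFiniteMeasure D] :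
    Integrable (fun p : 𝒳 × Bool => lbl p.2) D :=
  int_bdd lbl_meas2 1 (fun p => by rw [abs_of_nonneg (lbl_nonneg _)]; exact lbl_le _)

/-- fibers -/
def fib {m : ℕ} (idx : I01 → Fin m) (f : 𝒳 → I01) (j : Fin m) : Set (𝒳 × Bool) :=
  {p | idx (f p.1) = j}

lemma fib_meas {m : ℕ} {idx : I01 → Fin m} (hi : Measurable idx) {f : 𝒳 → I01}
    (hf : Measurable f) (j : Fin m) : MeasurableSet (fib idx f j) :=
  (hi.comp (hf.comp measurable_fst)) (measurableSet_singleton j)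

lemma fib_sum {m : ℕ} {idx : I01 → Fin m} (hi : Measurable idx) {f : 𝒳 → I01}
    (hf : Measurable f) (D : Measure (𝒳 × Bool)) {F : 𝒳 × Bool → ℝ} (hF : Integrable F D) :
    ∫ p, F p ∂D = ∑ j, ∫ p in fib idx f j, F p ∂D := by
  rw [← integral_iUnion_fintype (fun j => fib_meas hi hf j)]
  · have : (⋃ j, fib idx f j) = Set.univ := by
      ext p; simp [fib]
    rw [this, Measure.restrict_univ]
  · intro i j hij
    refine Set.disjoint_left.2 ?_
    intro p hp hq
    exact hij (hp.symm.trans hq)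
  · intro j; exact hF.integrableOn

lemma binned_eq (D : Measure (𝒳 × Bool)) {f : 𝒳 → I01} (hf : Measurable f)
    (P : IntervalPartition) {idx : I01 → Fin P.m} (hi : Measurable idx)
    (hP : ∀ (t : I01) j, (t : ℝ) ∈ P.piece j ↔ idx t = j) :
    binnedECE (predDist D f) P = ∑ j, |∫ p in fib idx f j, ((f p.1 : ℝ) - lbl p.2) ∂D| := by
  unfold binnedECE predDist
  refine Finset.sum_congr rfl fun j _ => ?_
  rw [integral_map (pred_meas hf).aemeasurable, ← integral_indicator (fib_meas hi hf j)]
  · congr 2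
    ext p
    simp [Set.indicator, fib, hP]
    congr
  · apply Measurable.aestronglyMeasurable
    have : (fun p : I01 × Bool => (P.piece j).indicator (fun _ => ((p.1 : ℝ) - lbl p.2)) (p.1 : ℝ))
        = ({p : I01 × Bool | (p.1 : ℝ) ∈ P.piece j}).indicator (fun p => ((p.1 : ℝ) - lbl p.2)) := by
      ext p; simp [Set.indicator]
    rw [this]
    refine Measurable.indicator ?_ ?_
    · exact (measurable_subtype_coe.comp measurable_fst).sub (lbl_meas.comp measurable_snd)
    · exact (measurable_subtype_coe.comp measurable_fst) (P.ordConn j).measurableSet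

lemma width_eq (D : Measure (𝒳 × Bool)) {f : 𝒳 → I01} (hf : Measurable f)
    (P : IntervalPartition) {idx : I01 → Fin P.m} (hi : Measurable idx)
    (hP : ∀ (t : I01) j, (t : ℝ) ∈ P.piece j ↔ idx t = j) :
    avgWidth (predDist D f) P = ∑ j, D.real (fib idx f j) * Metric.diam (P.piece j) := by
  unfold avgWidth predDist
  refine Finset.sum_congr rfl fun j _ => ?_
  congr 1
  rw [integral_map (pred_meas hf).aemeasurable]
  · have : (fun p : 𝒳 × Bool => (P.piece j).indicator (fun _ => (1 : ℝ)) (f p.1 : ℝ))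
        = (fib idx f j).indicator (fun _ => (1 : ℝ)) := by
      ext p; simp [Set.indicator, fib, hP]
      congr
    simp only [this]
    rw [integral_indicator (fib_meas hi hf j)]
    simp
  · apply Measurable.aestronglyMeasurable
    have : (fun p : I01 × Bool => (P.piece j).indicator (fun _ => (1 : ℝ)) (p.1 : ℝ))
        = ({p : I01 × Bool | (p.1 : ℝ) ∈ P.piece j}).indicator (fun p => (1 : ℝ)) := by
      ext p; simp [Set.indicator]
    rw [this]
    refine Measurable.indicator measurable_const ?_
    exact (measurable_subtype_coe.comp measurable_fst) (P.ordConn j).measurableSet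

lemma calErr_pred (D : Measure (𝒳 × Bool)) {f : 𝒳 → I01} (hf : Measurable f) {w : I01 → ℝ}
    (hw : Measurable w) :
    calErr (predDist D f) w = ∫ p, (lbl p.2 - (f p.1 : ℝ)) * w (f p.1) ∂D := by
  unfold calErr predDist
  rw [integral_map (pred_meas hf).aemeasurable]
  apply Measurable.aestronglyMeasurable
  exact ((lbl_meas.comp measurable_snd).sub (measurable_subtype_coe.comp measurable_fst)).mul
    (hw.comp measurable_fst)

lemma lower (D : Measure (𝒳 × Bool)) [IsProbabilityMeasure D] {f : 𝒳 → I01} (hf : Measurable f)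
    (P : IntervalPartition) : ∃ g ∈ calSet D, ∫ p, |(f p.1 : ℝ) - (g p.1 : ℝ)| ∂D ≤
      binnedECE (predDist D f) P + avgWidth (predDist D f) P := by
  obtain ⟨idx, hi, hP⟩ := exists_idx P
  rw [binned_eq D hf P hi hP, width_eq D hf P hi hP, ← Finset.sum_add_distrib]
  have hL0 : ∀ j, 0 ≤ ∫ p in fib idx f j, lbl p.2 ∂D := fun j =>
    integral_nonneg (fun p => lbl_nonneg _)
  have hL1 : ∀ j, ∫ p in fib idx f j, lbl p.2 ∂D ≤ D.real (fib idx f j) := by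
    intro j
    calc ∫ p in fib idx f j, lbl p.2 ∂D ≤ ∫ p in fib idx f j, (1 : ℝ) ∂D :=
          integral_mono (int_lbl D).integrableOn (integrable_const _) (fun p => lbl_le _)
      _ = _ := by simp
  let c : Fin P.m → I01 := fun j =>
    ⟨(∫ p in fib idx f j, lbl p.2 ∂D) / D.real (fib idx f j),
      div_nonneg (hL0 j) measureReal_nonneg, div_le_one_of_le₀ (hL1 j) measureReal_nonneg⟩
  have hc : ∀ j, D.real (fib idx f j) * (c j : ℝ) = ∫ p in fib idx f j, lbl p.2 ∂D := by
    intro j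
    by_cases h : D.real (fib idx f j) = 0
    · have h1 := hL1 j
      have h0 := hL0 j
      rw [h] at h1 ⊢
      linarith
    · simp only [c]
      field_simp
  have hcm : Measurable (fun x => c (idx (f x))) := (measurable_of_countable c).comp (hi.comp hf)
  refine ⟨fun x => c (idx (f x)), ⟨hcm, ?_⟩, ?_⟩
  · rintro w hw ⟨C, hC⟩
    rw [calErr_pred D hcm hw, fib_sum hi hf D]
    · refine Finset.sum_eq_zero fun j _ => ?_
      have : ∫ p in fib idx f j, (lbl p.2 - (c (idx (f p.1)) : ℝ)) * w (c (idx (f p.1))) ∂D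
          = ∫ p in fib idx f j, (lbl p.2 - (c j : ℝ)) * w (c j) ∂D := by
        refine setIntegral_congr_fun (fib_meas hi hf j) fun p hp => ?_
        have hp : idx (f p.1) = j := hp
        simp only [hp]
      rw [this, integral_mul_const, integral_sub (int_lbl D).integrableOn (integrable_const _),
        ← hc j]
      simp
    · refine Integrable.mul_bdd (c := C) ((int_lbl D).sub (int_val D hcm)) ?_ ?_
      · exact (hw.comp (hcm.comp measurable_fst)).aestronglyMeasurable
      · exact Filter.Eventually.of_forall (fun p => hC _)
  · rw [fib_sum hi hf D]
    · refine Finset.sum_le_sum fun j _ => ?_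
      set B := |∫ p in fib idx f j, ((f p.1 : ℝ) - lbl p.2) ∂D| with hB
      set q := D.real (fib idx f j) with hq
      have hbd : Bornology.IsBounded (P.piece j) :=
        (Metric.isBounded_Icc (0 : ℝ) 1).subset (P.cover ▸ Set.subset_iUnion P.piece j)
      have hpt : ∀ p ∈ fib idx f j, q * |(f p.1 : ℝ) - (c j : ℝ)| ≤ B + q * Metric.diam (P.piece j) := by
        intro p hp
        have e1 : q * ((f p.1 : ℝ) - c j) = (∫ r in fib idx f j, ((f p.1 : ℝ) - f r.1) ∂D)
            + ∫ r in fib idx f j, ((f r.1 : ℝ) - lbl r.2) ∂D := by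
          rw [integral_sub (integrable_const _) (int_val D hf).integrableOn,
            integral_sub (int_val D hf).integrableOn (int_lbl D).integrableOn, ← hc j]
          simp
          ring
        have e2 : |∫ r in fib idx f j, ((f p.1 : ℝ) - f r.1) ∂D| ≤ Metric.diam (P.piece j) * q := by
          rw [← Real.norm_eq_abs]
          refine norm_setIntegral_le_of_norm_le_const (μ := D) (s := fib idx f j) (measure_lt_top D _) ?_
          intro r hr
          exact Metric.dist_le_diam_of_mem hbd ((hP _ _).2 hp) ((hP _ _).2 hr)
        have e3 : q * |(f p.1 : ℝ) - (c j : ℝ)| = |q * ((f p.1 : ℝ) - c j)| := by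
          rw [abs_mul, abs_of_nonneg (measureReal_nonneg (μ := D))]
        rw [e3, e1]
        refine (abs_add_le _ _).trans ?_
        linarith
      have hfin : |∫ p in fib idx f j, |(f p.1 : ℝ) - (c (idx (f p.1)) : ℝ)| ∂D| ≤
          (B / q + Metric.diam (P.piece j)) * q := by
        by_cases h0 : q = 0
        · have : D.restrict (fib idx f j) = 0 := by
            rw [Measure.restrict_eq_zero]
            exact (measureReal_eq_zero_iff).1 h0
          rw [this, h0]; simp
        · have hq0 : 0 < q := lt_of_le_of_ne measureReal_nonneg (Ne.symm h0)
          rw [← Real.norm_eq_abs]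
          refine norm_setIntegral_le_of_norm_le_const (μ := D) (s := fib idx f j) (measure_lt_top D _) ?_
          intro p hp
          have hp' : idx (f p.1) = j := hp
          rw [hp', Real.norm_eq_abs, abs_abs]
          have := hpt p hp
          have e : B / q + Metric.diam (P.piece j) = (B + q * Metric.diam (P.piece j)) / q := by
            field_simp
          rw [e, le_div_iff₀ hq0]
          linarith
      refine (le_abs_self _).trans (hfin.trans ?_)
      have : B / q * q ≤ B := by
        by_cases h0 : q = 0
        · rw [h0]; simp [hB]
        · rw [div_mul_cancel₀ _ h0]
      linarith
    · exact ((int_val D hf).sub (int_val D hcm)).abs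

end

lemma fract_int (b : ℝ) : ∫ s in (0:ℝ)..1, Int.fract (b - s) = ∫ s in (0:ℝ)..1, Int.fract s := by
  rw [intervalIntegral.integral_comp_sub_left (fun x => Int.fract x) b]
  have hp : Function.Periodic (fun x : ℝ => Int.fract x) 1 := fun x => Int.fract_add_one x
  have := hp.intervalIntegral_add_eq (b - 1) 0
  simpa using this

lemma ii_bdd {F : ℝ → ℝ} (hF : Measurable F) (C : ℝ) (hC : ∀ p, |F p| ≤ C) (a b : ℝ) :
    IntervalIntegrable F volume a b :=
  ⟨int_bdd hF C hC, int_bdd hF C hC⟩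

lemma fract_ii (b : ℝ) : IntervalIntegrable (fun s => Int.fract (b - s)) volume 0 1 :=
  ii_bdd (measurable_fract.comp (measurable_const.sub measurable_id)) 1 (fun p => by
    rw [abs_of_nonneg (Int.fract_nonneg _)]; exact (Int.fract_lt_one _).le) _ _

lemma shift_int (a b : ℝ) :
    ∫ s in (0:ℝ)..1, |(⌊b - s⌋ : ℝ) - ⌊a - s⌋| = |b - a| := by
  wlog hab : a ≤ b generalizing a b
  · rw [abs_sub_comm b a, ← this b a (le_of_not_ge hab)]
    congr 1; ext s; rw [abs_sub_comm]
  have h : ∀ s : ℝ, |(⌊b - s⌋ : ℝ) - ⌊a - s⌋| =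
      (b - a) - (Int.fract (b - s) - Int.fract (a - s)) := by
    intro s
    have : (⌊a - s⌋ : ℝ) ≤ ⌊b - s⌋ := by exact_mod_cast Int.floor_le_floor (by linarith)
    rw [abs_of_nonneg (by linarith)]
    simp only [Int.fract]; ring
  simp only [h]
  rw [intervalIntegral.integral_sub (by simp) ((fract_ii b).sub (fract_ii a)),
    intervalIntegral.integral_sub (fract_ii b) (fract_ii a), fract_int, fract_int,
    abs_of_nonneg (by linarith)]
  simp

lemma exists_grid (ε s : ℝ) (hε : 0 < ε) : ∃ (P : IntervalPartition) (k : Fin P.m → ℤ),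
    Function.Injective k ∧
    (∀ j, P.piece j = {t | t ∈ Set.Icc (0:ℝ) 1 ∧ ⌊t / ε - s⌋ = k j}) := by
  have hmono : ∀ x y : ℝ, x ≤ y → ⌊x / ε - s⌋ ≤ ⌊y / ε - s⌋ := fun x y h =>
    Int.floor_le_floor (by gcongr)
  let m : ℕ := (⌊1 / ε - s⌋ - ⌊0 / ε - s⌋ + 1).toNat
  let k : Fin m → ℤ := fun i => ⌊0 / ε - s⌋ + (i : ℕ)
  have hk : Function.Injective k := by
    intro i j h
    simp only [k] at h
    ext; omega
  refine ⟨⟨m, fun j => {t | t ∈ Set.Icc (0:ℝ) 1 ∧ ⌊t / ε - s⌋ = k j}, ?_, ?_, ?_⟩, k, hk, fun j => rfl⟩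
  · intro j
    constructor
    rintro x ⟨hx, hx'⟩ y ⟨hy, hy'⟩ z ⟨hz, hz'⟩
    refine ⟨⟨hx.1.trans hz, hz'.trans hy.2⟩, le_antisymm ?_ ?_⟩
    · rw [← hy']; exact hmono _ _ hz'
    · rw [← hx']; exact hmono _ _ hz
  · intro i j hij
    refine Set.disjoint_left.2 ?_
    rintro x ⟨_, h1⟩ ⟨_, h2⟩
    exact hij (hk (h1.symm.trans h2))
  · ext x
    simp only [Set.mem_iUnion]
    constructor
    · rintro ⟨j, h, _⟩; exact h
    · intro hx
      have h1 := hmono _ _ hx.1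
      have h2 := hmono _ _ hx.2
      refine ⟨⟨(⌊x / ε - s⌋ - ⌊0 / ε - s⌋).toNat, ?_⟩, hx, ?_⟩
      · simp only [m]; omega
      · simp only [k]; omega

lemma sum_ind {m : ℕ} (i k : Fin m) :
    ∑ j, |(if i = j then (1:ℝ) else 0) - (if k = j then 1 else 0)| ≤ if i = k then 0 else 2 := by
  split_ifs with h
  · subst h; simp
  · calc _ ≤ ∑ j, ((if i = j then (1:ℝ) else 0) + (if k = j then 1 else 0)) := by
          refine Finset.sum_le_sum fun j _ => ?_
          split_ifs <;> norm_num
      _ = 2 := by rw [Finset.sum_add_distrib]; simp; norm_num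

section
variable {𝒳 : Type*} [MeasurableSpace 𝒳]

lemma intCE_le (Γ : Measure (I01 × Bool)) (P : IntervalPartition) :
    intCE Γ ≤ binnedECE Γ P + avgWidth Γ P := by
  refine csInf_le ⟨0, ?_⟩ ⟨P, rfl⟩
  rintro x ⟨Q, rfl⟩
  refine add_nonneg (Finset.sum_nonneg fun j _ => abs_nonneg _)
    (Finset.sum_nonneg fun j _ => mul_nonneg (integral_nonneg fun p => ?_) Metric.diam_nonneg)
  exact Set.indicator_nonneg (fun _ _ => zero_le_one) _

lemma floor_meas {f : 𝒳 → I01} (hf : Measurable f) (ε : ℝ) :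
    Measurable (fun z : (𝒳 × Bool) × ℝ => (⌊(f z.1.1 : ℝ) / ε - z.2⌋ : ℝ)) := by
  have h1 : Measurable (fun z : (𝒳 × Bool) × ℝ => (f z.1.1 : ℝ) / ε - z.2) :=
    (((val_meas hf).comp measurable_fst).div_const ε).sub measurable_snd
  exact (measurable_of_countable (fun n : ℤ => (n : ℝ))).comp h1.floor

lemma floor_bd (ε : ℝ) (hε : 0 < ε) (u v : I01) (s : ℝ) :
    |(⌊(u : ℝ) / ε - s⌋ : ℝ) - ⌊(v : ℝ) / ε - s⌋| ≤ 1 / ε + 1 := by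
  have h1 := Int.floor_le ((u : ℝ) / ε - s)
  have h2 := Int.lt_floor_add_one ((u : ℝ) / ε - s)
  have h3 := Int.floor_le ((v : ℝ) / ε - s)
  have h4 := Int.lt_floor_add_one ((v : ℝ) / ε - s)
  have a1 : 0 ≤ (u : ℝ) / ε := div_nonneg u.2.1 hε.le
  have a2 : 0 ≤ (v : ℝ) / ε := div_nonneg v.2.1 hε.le
  have a3 : (u : ℝ) / ε ≤ 1 / ε := by gcongr; exact u.2.2
  have a4 : (v : ℝ) / ε ≤ 1 / ε := by gcongr; exact v.2.2
  rw [abs_le]; constructor <;> linarith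

lemma exists_shift (D : Measure (𝒳 × Bool)) [IsProbabilityMeasure D] {f g : 𝒳 → I01}
    (hf : Measurable f) (hg : Measurable g) (ε : ℝ) (hε : 0 < ε) :
    ∃ s : ℝ, ∫ p, |(⌊(f p.1 : ℝ) / ε - s⌋ : ℝ) - ⌊(g p.1 : ℝ) / ε - s⌋| ∂D ≤
      (∫ p, |(f p.1 : ℝ) - (g p.1 : ℝ)| ∂D) / ε := by
  have : IsProbabilityMeasure (volume.restrict (Set.Ioc (0:ℝ) 1)) := ⟨by simp⟩
  have hint : Integrable (Function.uncurry fun (p : 𝒳 × Bool) (s : ℝ) =>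
      |(⌊(f p.1 : ℝ) / ε - s⌋ : ℝ) - ⌊(g p.1 : ℝ) / ε - s⌋|)
      (D.prod (volume.restrict (Set.Ioc (0:ℝ) 1))) := by
    refine int_bdd ?_ (1 / ε + 1) ?_
    · have := ((floor_meas hf ε).sub (floor_meas hg ε)).norm
      exact this
    · intro z
      simp only [Function.uncurry, abs_abs]
      exact floor_bd ε hε _ _ _
  obtain ⟨s, hs⟩ := exists_le_integral (hint.integral_prod_right)
  refine ⟨s, hs.trans_eq ?_⟩
  simp only [Function.uncurry]
  rw [← integral_integral_swap hint, ← integral_div]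
  congr 1; ext p
  rw [← intervalIntegral.integral_of_le zero_le_one, shift_int, ← sub_div, abs_div,
    abs_of_pos hε]

lemma upper (D : Measure (𝒳 × Bool)) [IsProbabilityMeasure D] {f g : 𝒳 → I01}
    (hf : Measurable f) (hg : g ∈ calSet D) (ε : ℝ) (hε : 0 < ε) :
    intCE (predDist D f) ≤ (∫ p, |(f p.1 : ℝ) - (g p.1 : ℝ)| ∂D) * (1 + 2 / ε) + ε := by
  obtain ⟨hgm, hcal⟩ := hg
  obtain ⟨s, hs⟩ := exists_shift D hf hgm ε hε
  obtain ⟨P, k, hk, hpiece⟩ := exists_grid ε s hε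
  obtain ⟨idx, hi, hP⟩ := exists_idx P
  refine (intCE_le _ P).trans ?_
  rw [binned_eq D hf P hi hP, width_eq D hf P hi hP]
  have hidx : ∀ t : I01, ⌊(t : ℝ) / ε - s⌋ = k (idx t) := by
    intro t
    have := (hP t (idx t)).2 rfl
    rw [hpiece] at this
    exact this.2
  have hdiam : ∀ j, Metric.diam (P.piece j) ≤ ε := by
    intro j
    refine Metric.diam_le_of_forall_dist_le hε.le ?_
    rw [hpiece]
    rintro x ⟨_, hx⟩ y ⟨_, hy⟩
    have := Int.abs_sub_lt_one_of_floor_eq_floor (hx.trans hy.symm)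
    have e : x / ε - s - (y / ε - s) = (x - y) / ε := by ring
    rw [e, abs_div, abs_of_pos hε, div_lt_one hε] at this
    exact this.le
  have hw : ∑ j, D.real (fib idx f j) * Metric.diam (P.piece j) ≤ ε := by
    have h1 := fib_sum hi hf D (integrable_const (1:ℝ))
    simp only [integral_const, probReal_univ, smul_eq_mul, mul_one, measureReal_restrict_apply_univ] at h1
    calc _ ≤ ∑ j, D.real (fib idx f j) * ε :=
          Finset.sum_le_sum fun j _ => mul_le_mul_of_nonneg_left (hdiam j) measureReal_nonneg
      _ = ε := by rw [← Finset.sum_mul, ← h1, one_mul]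
  have hmI : ∀ {h : 𝒳 → I01} (hh : Measurable h) (j : Fin P.m),
      Measurable (fun p : 𝒳 × Bool => if idx (h p.1) = j then (1:ℝ) else 0) := by
    intro h hh j
    exact Measurable.ite (fib_meas hi hh j) measurable_const measurable_const
  let G : Fin P.m → 𝒳 × Bool → ℝ := fun j p =>
    (if idx (f p.1) = j then (1:ℝ) else 0) * |(f p.1 : ℝ) - g p.1| +
      |(if idx (f p.1) = j then (1:ℝ) else 0) - (if idx (g p.1) = j then 1 else 0)|
  have hfg : Integrable (fun p : 𝒳 × Bool => |(f p.1 : ℝ) - g p.1|) D :=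
    ((int_val D hf).sub (int_val D hgm)).abs
  have hGi : ∀ j, Integrable (G j) D := by
    intro j
    refine Integrable.add ?_ ?_
    · refine hfg.bdd_mul (c := 1) (hmI hf j).aestronglyMeasurable
        (Filter.Eventually.of_forall fun p => ?_)
      split_ifs <;> simp
    · refine int_bdd ((hmI hf j).sub (hmI hgm j)).norm 1 ?_
      intro p
      simp only [Real.norm_eq_abs, abs_abs, Pi.sub_apply]
      split_ifs <;> simp
  have hj : ∀ j, |∫ p in fib idx f j, ((f p.1 : ℝ) - lbl p.2) ∂D| ≤ ∫ p, G j p ∂D := by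
    intro j
    have hwj : Measurable (fun t : I01 => if idx t = j then (1:ℝ) else 0) :=
      Measurable.ite (hi (measurableSet_singleton j)) measurable_const measurable_const
    have hc := hcal (fun t => if idx t = j then (1:ℝ) else 0) hwj ⟨1, fun t => by
      split_ifs <;> simp⟩
    rw [calErr_pred D hgm hwj] at hc
    have i1 : Integrable (fun p : 𝒳 × Bool => ((f p.1 : ℝ) - lbl p.2) * if idx (f p.1) = j then (1:ℝ) else 0) D := by
      refine ((int_val D hf).sub (int_lbl D)).mul_bdd (c := 1) (hmI hf j).aestronglyMeasurable
        (Filter.Eventually.of_forall fun p => ?_)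
      split_ifs <;> simp
    have i2 : Integrable (fun p : 𝒳 × Bool => (lbl p.2 - (g p.1 : ℝ)) * if idx (g p.1) = j then (1:ℝ) else 0) D := by
      refine ((int_lbl D).sub (int_val D hgm)).mul_bdd (c := 1) (hmI hgm j).aestronglyMeasurable
        (Filter.Eventually.of_forall fun p => ?_)
      split_ifs <;> simp
    have e : ∫ p in fib idx f j, ((f p.1 : ℝ) - lbl p.2) ∂D =
        ∫ p, (((f p.1 : ℝ) - lbl p.2) * (if idx (f p.1) = j then (1:ℝ) else 0) +
          (lbl p.2 - (g p.1 : ℝ)) * (if idx (g p.1) = j then (1:ℝ) else 0)) ∂D := by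
      rw [integral_add i1 i2, hc, add_zero, ← integral_indicator (fib_meas hi hf j)]
      congr 1; ext p
      simp [Set.indicator, fib]
      congr
    rw [e]
    refine (abs_integral_le_integral_abs).trans (integral_mono (i1.add i2).abs (hGi j) ?_)
    intro p
    simp only [G]
    have b1 : |(g p.1 : ℝ) - lbl p.2| ≤ 1 := by
      rw [abs_le]
      have := lbl_nonneg p.2
      have := lbl_le p.2
      have := (g p.1).2.1
      have := (g p.1).2.2
      constructor <;> linarith
    generalize (f p.1 : ℝ) = u at *
    generalize (g p.1 : ℝ) = v at *
    generalize lbl p.2 = y at *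
    have e2 : ∀ α β : ℝ, (u - y) * α + (y - v) * β = α * (u - v) + (v - y) * (α - β) := by
      intros; ring
    rw [e2]
    refine (abs_add_le _ _).trans ?_
    rw [abs_mul, abs_mul]
    refine add_le_add ?_ ?_
    · split_ifs <;> simp
    · exact mul_le_of_le_one_left (abs_nonneg _) b1
  have hfl : Integrable (fun p : 𝒳 × Bool => |(⌊(f p.1 : ℝ) / ε - s⌋ : ℝ) - ⌊(g p.1 : ℝ) / ε - s⌋|) D := by
    refine int_bdd ?_ (1 / ε + 1) ?_
    · have h0 : Measurable (fun p : 𝒳 × Bool => (p, s)) := measurable_id.prodMk measurable_const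
      exact (((floor_meas hf ε).sub (floor_meas hgm ε)).comp h0).norm
    · intro p
      rw [abs_abs]
      exact floor_bd ε hε _ _ _
  have hb : ∑ j, |∫ p in fib idx f j, ((f p.1 : ℝ) - lbl p.2) ∂D| ≤
      ∫ p, (|(f p.1 : ℝ) - g p.1| + 2 * |(⌊(f p.1 : ℝ) / ε - s⌋ : ℝ) - ⌊(g p.1 : ℝ) / ε - s⌋|) ∂D := by
    refine (Finset.sum_le_sum fun j _ => hj j).trans ?_
    rw [← integral_finsetSum _ (fun j _ => hGi j)]
    refine integral_mono (integrable_finsetSum _ (fun j _ => hGi j)) (hfg.add (hfl.const_mul 2)) ?_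
    intro p
    simp only [G, Finset.sum_add_distrib, ← Finset.sum_mul]
    refine add_le_add (by simp) ((sum_ind _ _).trans ?_)
    split_ifs with h
    · positivity
    · rw [hidx, hidx]
      have h1 : k (idx (f p.1)) - k (idx (g p.1)) ≠ 0 := fun h' => h (hk (by omega))
      have h2 : (1 : ℝ) ≤ |(k (idx (f p.1)) : ℝ) - k (idx (g p.1))| := by
        exact_mod_cast Int.one_le_abs h1
      linarith
  rw [integral_add hfg (hfl.const_mul 2), integral_const_mul] at hb
  have : (∫ p, |(f p.1 : ℝ) - (g p.1 : ℝ)| ∂D) * (1 + 2 / ε) =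
    (∫ p, |(f p.1 : ℝ) - (g p.1 : ℝ)| ∂D) + 2 * ((∫ p, |(f p.1 : ℝ) - (g p.1 : ℝ)| ∂D) / ε) := by ring
  linarith

end

/-- For every distribution `D` over `𝒳×{0,1}` and measurable predictor `f`,
`dCE_D(f) ≤ intCE(D_f) ≤ 4·√(dCE_D(f))`. -/
theorem dCE_le_intCE_le_sqrt_dCE {𝒳 : Type*} [MeasurableSpace 𝒳]
    (D : Measure (𝒳 × Bool)) [IsProbabilityMeasure D] (f : 𝒳 → I01) (hf : Measurable f) :
    dCE D f ≤ intCE (predDist D f) ∧ intCE (predDist D f) ≤ 4 * Real.sqrt (dCE D f) := by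
  obtain ⟨P₀, _⟩ := exists_grid 1 0 one_pos
  have hbdd : ∀ x ∈ {x | ∃ g ∈ calSet D, x = ∫ p, |(f p.1 : ℝ) - (g p.1 : ℝ)| ∂D}, 0 ≤ x := by
    rintro x ⟨g, _, rfl⟩
    exact integral_nonneg fun p => abs_nonneg _
  obtain ⟨g₀, hg₀, _⟩ := lower D hf P₀
  have hd0 : 0 ≤ dCE D f := Real.sInf_nonneg hbdd
  have hd1 : dCE D f ≤ 1 := by
    refine (csInf_le ⟨0, hbdd⟩ ⟨g₀, hg₀, rfl⟩).trans ?_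
    calc _ ≤ ∫ p, (1 : ℝ) ∂D := by
          refine integral_mono ((int_val D hf).sub (int_val D hg₀.1)).abs (integrable_const _) ?_
          intro p
          have := (f p.1).2.1
          have := (f p.1).2.2
          have := (g₀ p.1).2.1
          have := (g₀ p.1).2.2
          simp only [abs_le]
          constructor <;> linarith
      _ = 1 := by simp
  constructor
  · refine le_csInf ⟨_, P₀, rfl⟩ ?_
    rintro x ⟨P, rfl⟩
    obtain ⟨g, hg, hle⟩ := lower D hf P
    exact (csInf_le ⟨0, hbdd⟩ ⟨g, hg, rfl⟩).trans hle
  · have key : ∀ ε : ℝ, 0 < ε → intCE (predDist D f) ≤ dCE D f * (1 + 2 / ε) + ε := by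
      intro ε hε
      have hpos : 0 < 1 + 2 / ε := by positivity
      have : (intCE (predDist D f) - ε) / (1 + 2 / ε) ≤ dCE D f := by
        refine le_csInf ⟨_, g₀, hg₀, rfl⟩ ?_
        rintro x ⟨g, hg, rfl⟩
        rw [div_le_iff₀ hpos]
        have := upper D hf hg ε hε
        linarith
      rw [div_le_iff₀ hpos] at this
      linarith
    rcases hd0.eq_or_lt with h | h
    · rw [← h] at key ⊢
      simp only [Real.sqrt_zero, mul_zero]
      refine le_of_forall_pos_le_add fun ε hε => ?_
      have := key ε hε
      linarith
    · have hs := Real.sqrt_pos.2 h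
      have h1 := key _ hs
      have h2 := Real.mul_self_sqrt h.le
      have h3 : Real.sqrt (dCE D f) ≤ 1 := Real.sqrt_le_one.2 hd1
      set r := Real.sqrt (dCE D f)
      have h4 : dCE D f * (1 + 2 / r) = r * r + 2 * r := by
        rw [← h2]; field_simp
      rw [h4] at h1
      nlinarith
end
end

section
/- For every α ∈ (0,1/2], there exist a finite set 𝒳 (a four-element set suffices), a predictor f:𝒳→[0,1], and two probability distributions D¹ and D² on 𝒳×{0,1} such that the prediction-label distributions D¹_f and D²_f are identical, dCE_{D¹}(f) ≤ 2α², and dCE_{D²}(f) ≥ α. -/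
open MeasureTheory Set

noncomputable section

def mkM (c : Fin 4 × Bool → ℝ) : Measure (Fin 4 × Bool) :=
  ∑ p, ENNReal.ofReal (c p) • Measure.dirac p

lemma mkM_integral (c : Fin 4 × Bool → ℝ) (hc : ∀ p, 0 ≤ c p) (F : Fin 4 × Bool → ℝ) :
    ∫ p, F p ∂(mkM c) = ∑ p, c p * F p := by
  unfold mkM
  rw [integral_finset_sum_measure]
  · refine Finset.sum_congr rfl fun p _ => ?_
    rw [integral_smul_measure, integral_dirac, ENNReal.toReal_ofReal (hc p), smul_eq_mul]
  · intro p _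
    exact (integrable_dirac (by simp)).smul_measure (by simp)

lemma mkM_sum (F : Fin 4 × Bool → ℝ) : ∑ p, F p =
    F (0, true) + F (0, false) + (F (1, true) + F (1, false)) + (F (2, true) + F (2, false))
      + (F (3, true) + F (3, false)) := by
  rw [Fintype.sum_prod_type]
  simp [Fin.sum_univ_four]

lemma mkM_prob (c : Fin 4 × Bool → ℝ) (hc : ∀ p, 0 ≤ c p) (h : ∑ p, c p = 1) :
    IsProbabilityMeasure (mkM c) := by
  constructor
  unfold mkM
  simp only [Measure.coe_finset_sum, Finset.sum_apply, Measure.smul_apply, measure_univ,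
    smul_eq_mul, mul_one]
  rw [← ENNReal.ofReal_sum_of_nonneg (fun p _ => hc p), h, ENNReal.ofReal_one]

lemma mkM_map (c : Fin 4 × Bool → ℝ) (hc : ∀ p, 0 ≤ c p) (f : Fin 4 → I01)
    (s : Set (I01 × Bool)) (hs : MeasurableSet s) :
    predDist (mkM c) f s
      = ENNReal.ofReal (∑ p, c p * s.indicator (fun _ => (1:ℝ)) (f p.1, p.2)) := by
  unfold predDist
  rw [Measure.map_apply (measurable_of_countable _) hs]
  unfold mkM
  simp only [Measure.coe_finset_sum, Finset.sum_apply, Measure.smul_apply, smul_eq_mul]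
  rw [ENNReal.ofReal_sum_of_nonneg
    (fun p _ => mul_nonneg (hc p) (indicator_nonneg (fun _ _ => zero_le_one) _))]
  refine Finset.sum_congr rfl fun p _ => ?_
  rw [ENNReal.ofReal_mul (hc p), Measure.dirac_apply' _ (measurable_of_countable _ hs)]
  congr 1
  by_cases h : (f p.1, p.2) ∈ s <;> simp [h, indicator]

lemma mkM_calErr (c : Fin 4 × Bool → ℝ) (hc : ∀ p, 0 ≤ c p) (g : Fin 4 → I01)
    (w : I01 → ℝ) (hw : Measurable w) :
    calErr (predDist (mkM c) g) w = ∑ p, c p * ((lbl p.2 - (g p.1 : ℝ)) * w (g p.1)) := by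
  unfold calErr predDist
  rw [integral_map (measurable_of_countable _).aemeasurable]
  · exact mkM_integral c hc _
  · have hl : Measurable lbl := measurable_of_countable _
    apply Measurable.aestronglyMeasurable
    fun_prop

def cc1 (α : ℝ) : Fin 4 × Bool → ℝ := fun p =>
  if p.2 then ![1/4 - α/2, α/2, 0, 1/4] p.1 else ![1/4, 0, α/2, 1/4 - α/2] p.1

def cc2 : Fin 4 × Bool → ℝ := fun p => ![1/4, 0, 0, 1/4] p.1

theorem dCE_not_determined_by_predDist (α : ℝ) (hα : 0 < α) (hα' : α ≤ 1 / 2) :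
    ∃ (f : Fin 4 → I01) (D₁ D₂ : Measure (Fin 4 × Bool)),
      IsProbabilityMeasure D₁ ∧ IsProbabilityMeasure D₂ ∧
      predDist D₁ f = predDist D₂ f ∧
      dCE D₁ f ≤ 2 * α ^ 2 ∧ α ≤ dCE D₂ f := by
  have h1 : ∀ p, 0 ≤ cc1 α p := by
    rintro ⟨i, b⟩
    fin_cases i <;> cases b <;> simp [cc1] <;> linarith
  have h2 : ∀ p, 0 ≤ cc2 p := by
    rintro ⟨i, b⟩
    fin_cases i <;> cases b <;> simp [cc2]
  let l : I01 := ⟨1/2 - α, by constructor <;> linarith⟩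
  let h : I01 := ⟨1/2 + α, by constructor <;> linarith⟩
  let m : I01 := ⟨1/2, by constructor <;> linarith⟩
  have hl : (l : ℝ) = 1/2 - α := rfl
  have hh : (h : ℝ) = 1/2 + α := rfl
  have hm : (m : ℝ) = 1/2 := rfl
  clear_value l h m
  refine ⟨![l, l, h, h], mkM (cc1 α), mkM cc2, mkM_prob _ h1 ?_, mkM_prob _ h2 ?_, ?_, ?_, ?_⟩
  · rw [mkM_sum]; simp [cc1]; ring
  · rw [mkM_sum]; simp [cc2]; norm_num
  · ext s hs
    rw [mkM_map _ h1 _ _ hs, mkM_map _ h2 _ _ hs, mkM_sum, mkM_sum]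
    congr 1
    simp [cc1, cc2]
    ring
  · apply csInf_le
    · refine ⟨0, ?_⟩
      rintro x ⟨g, -, rfl⟩
      exact integral_nonneg fun p => abs_nonneg _
    · refine ⟨![l, h, l, h], ⟨measurable_of_countable _, ?_⟩, ?_⟩
      · intro w hw _
        rw [mkM_calErr _ h1 _ _ hw, mkM_sum]
        simp [cc1, lbl, hl, hh]
        ring
      · rw [mkM_integral _ h1, mkM_sum]
        have e1 : |1/2 - α - (1/2 + α)| = 2 * α := by
          rw [abs_of_nonpos (by linarith)]; ring
        simp only [cc1]
        simp [hl, hh, -one_div, e1]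
        ring_nf
        rw [abs_of_pos (by linarith : 0 < α * 2)]
        ring
  · apply le_csInf
    · refine ⟨_, fun _ => m, ⟨measurable_const, ?_⟩, rfl⟩
      intro w hw _
      rw [mkM_calErr _ h2 _ _ hw, mkM_sum]
      simp [cc2, lbl, hm]
      ring
    · rintro x ⟨g, ⟨-, hg⟩, rfl⟩
      have hw : Measurable (fun v : I01 => 1 - 2 * (v : ℝ)) := by fun_prop
      have := hg _ hw ⟨1, fun t => by
        have := t.2.1; have := t.2.2
        rw [abs_le]; constructor <;> linarith⟩
      rw [mkM_calErr _ h2 _ _ hw, mkM_sum] at this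
      simp [cc2, lbl] at this
      have g0 : (g 0 : ℝ) = 1/2 := by
        nlinarith [sq_nonneg (1 - 2 * (g 0 : ℝ)), sq_nonneg (1 - 2 * (g 3 : ℝ))]
      have g3 : (g 3 : ℝ) = 1/2 := by
        nlinarith [sq_nonneg (1 - 2 * (g 0 : ℝ)), sq_nonneg (1 - 2 * (g 3 : ℝ))]
      rw [mkM_integral _ h2, mkM_sum]
      simp [cc2, hl, hh, g0, g3, abs_of_pos hα]
      linarith
end
end
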